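/- arXiv:1005.2598 — 2 statements merged into one kernel-verified Lean document; each statement's English description precedes it below -/
import Mathlib

section
/- For T > 0, let X_T be a random variable uniformly distributed on (0,T), and let d(T) denote the Kolmogorov–Smirnov distance between the distribution of the fractional part of log₁₀ X_T and the uniform distribution on [0,1). Then there exists a continuous function f : ℝ → ℝ that is periodic with period 1 such that d(T) = f(log₁₀ T) for all T > 0; in particular, d(10·T) = d(T) for all T > 0. -/
open MeasureTheory Set

/-- The Kolmogorov–Smirnov distance between two (Borel) measures on `ℝ`:
the supremum over `x ∈ ℝ` of the absolute difference of their cumulative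
distribution functions. -/
noncomputable def ksDist (μ ν : Measure ℝ) : ℝ :=
  ⨆ x : ℝ, |(μ (Iic x)).toReal - (ν (Iic x)).toReal|

/-- `d T` is the Kolmogorov–Smirnov distance between the distribution of the fractional part
of `log₁₀ X_T`, where `X_T` is uniformly distributed on `(0, T)`, and the uniform
distribution on `[0, 1)`. -/
noncomputable def ksDistUnif (T : ℝ) : ℝ :=
  ksDist
    (Measure.map (fun x => Int.fract (Real.logb 10 x))
      ((ENNReal.ofReal T)⁻¹ • volume.restrict (Ioo 0 T)))
    (volume.restrict (Ico 0 1))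

/-- The points of `(0, T)` whose base-`10` logarithm has fractional part at most `x`. -/
def fractLogbSet (T x : ℝ) : Set ℝ :=
  {y | Int.fract (Real.logb 10 y) ≤ x} ∩ Ioo 0 T

lemma measurable_fract_logb (b : ℝ) : Measurable fun y => Int.fract (Real.logb b y) :=
  measurable_fract.comp (Real.measurable_log.div_const _)

lemma volume_fractLogbSet_ne_top (T x : ℝ) : volume (fractLogbSet T x) ≠ ⊤ :=
  measure_ne_top_of_subset inter_subset_right measure_Ioo_lt_top.ne

lemma volume_real_fractLogbSet_mono {S T : ℝ} (h : S ≤ T) (x : ℝ) :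
    volume.real (fractLogbSet S x) ≤ volume.real (fractLogbSet T x) :=
  measureReal_mono (inter_subset_inter_right _ (Ioo_subset_Ioo_right h))
    (volume_fractLogbSet_ne_top T x)

lemma volume_real_fractLogbSet_le {T : ℝ} (hT : 0 ≤ T) (x : ℝ) :
    volume.real (fractLogbSet T x) ≤ T := by
  calc volume.real (fractLogbSet T x) ≤ volume.real (Ioo 0 T) :=
        measureReal_mono inter_subset_right measure_Ioo_lt_top.ne
    _ = T := by simp [Real.volume_real_Ioo_of_le hT]

lemma volume_real_fractLogbSet_le_add {S T : ℝ} (h : S ≤ T) (x : ℝ) :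
    volume.real (fractLogbSet T x) ≤ volume.real (fractLogbSet S x) + (T - S) := by
  have hsub : fractLogbSet T x ⊆ fractLogbSet S x ∪ Ico S T := by
    rintro y ⟨hy, h0, hyT⟩
    rcases lt_or_ge y S with hS | hS
    · exact Or.inl ⟨hy, h0, hS⟩
    · exact Or.inr ⟨hS, hyT⟩
  calc volume.real (fractLogbSet T x) ≤ volume.real (fractLogbSet S x ∪ Ico S T) :=
        measureReal_mono hsub
          (measure_union_ne_top (volume_fractLogbSet_ne_top S x) measure_Ico_lt_top.ne)
    _ ≤ volume.real (fractLogbSet S x) + volume.real (Ico S T) := measureReal_union_le _ _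
    _ = volume.real (fractLogbSet S x) + (T - S) := by rw [Real.volume_real_Ico_of_le h]

open scoped Pointwise in
lemma fractLogbSet_ten_mul (T x : ℝ) :
    fractLogbSet (10 * T) x = (10 : ℝ) • fractLogbSet T x := by
  ext y
  have hy (h : 0 < y) : Int.fract (Real.logb 10 (10⁻¹ * y)) = Int.fract (Real.logb 10 y) := by
    rw [Real.logb_mul (by norm_num) h.ne', Real.logb_inv, Real.logb_self_eq_one (by norm_num),
      neg_add_eq_sub, Int.fract_sub_one]
  rw [Set.mem_smul_set_iff_inv_smul_mem₀ (by norm_num), smul_eq_mul]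
  simp only [fractLogbSet, mem_inter_iff, mem_ofPred_eq, mem_Ioo]
  constructor
  · rintro ⟨h, h0, hT⟩
    exact ⟨(hy h0).trans_le h, by linarith, by linarith⟩
  · rintro ⟨h, h0, hT⟩
    exact ⟨(hy (by linarith)).symm.trans_le h, by linarith, by linarith⟩

lemma volume_real_fractLogbSet_ten_mul (T x : ℝ) :
    volume.real (fractLogbSet (10 * T) x) = 10 * volume.real (fractLogbSet T x) := by
  rw [measureReal_def, fractLogbSet_ten_mul, Measure.addHaar_smul, ENNReal.toReal_mul, measureReal_def]
  norm_num

/-- The distance is the supremum of the explicit differences of distribution functions. -/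
lemma ksDistUnif_eq_iSup {T : ℝ} (hT : 0 < T) :
    ksDistUnif T = ⨆ x : ℝ, |volume.real (fractLogbSet T x) / T
      - (volume.restrict (Ico (0 : ℝ) 1)).real (Iic x)| := by
  unfold ksDistUnif ksDist
  congr! 4 with x
  have hm := measurable_fract_logb 10
  rw [Measure.map_apply hm measurableSet_Iic, Measure.smul_apply,
    Measure.restrict_apply (hm measurableSet_Iic), smul_eq_mul, ENNReal.toReal_mul,
    ENNReal.toReal_inv, ENNReal.toReal_ofReal hT.le, inv_mul_eq_div]
  rfl

lemma ksDistUnif_ten_mul {T : ℝ} (hT : 0 < T) : ksDistUnif (10 * T) = ksDistUnif T := by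
  rw [ksDistUnif_eq_iSup hT, ksDistUnif_eq_iSup (by positivity)]
  simp_rw [volume_real_fractLogbSet_ten_mul, mul_div_mul_left _ T (by norm_num : (10 : ℝ) ≠ 0)]

lemma bddAbove_abs_sub_fractLogbSet {T : ℝ} (hT : 0 < T) :
    BddAbove (range fun x : ℝ => |volume.real (fractLogbSet T x) / T
      - (volume.restrict (Ico (0 : ℝ) 1)).real (Iic x)|) := by
  refine ⟨1, ?_⟩
  rintro _ ⟨x, rfl⟩
  have h0 : 0 ≤ volume.real (fractLogbSet T x) / T := by positivity
  have h1 := div_le_one_of_le₀ (volume_real_fractLogbSet_le hT.le x) hT.le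
  have : IsProbabilityMeasure (volume.restrict (Ico (0 : ℝ) 1)) := ⟨by simp⟩
  have h2 : (volume.restrict (Ico (0 : ℝ) 1)).real (Iic x) ≤ 1 := measureReal_le_one
  have h3 : 0 ≤ (volume.restrict (Ico (0 : ℝ) 1)).real (Iic x) := measureReal_nonneg
  exact abs_le.2 ⟨by linarith, by linarith⟩

lemma abs_volume_real_fractLogbSet_div_sub_le_of_le {S T : ℝ} (hS : 0 < S) (h : S ≤ T) (x : ℝ) :
    |volume.real (fractLogbSet T x) / T - volume.real (fractLogbSet S x) / S| ≤ (T - S) / T := by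
  have hT : 0 < T := hS.trans_le h
  have h1 := volume_real_fractLogbSet_mono h x
  have h2 := volume_real_fractLogbSet_le_add h x
  have h3 := volume_real_fractLogbSet_le hS.le x
  have h4 : 0 ≤ volume.real (fractLogbSet S x) := measureReal_nonneg
  rw [div_sub_div _ _ hT.ne' hS.ne', abs_div, abs_of_pos (mul_pos hT hS),
    div_le_div_iff₀ (mul_pos hT hS) hT, mul_comm T S, ← mul_assoc]
  refine mul_le_mul_of_nonneg_right (abs_le.2 ⟨?_, ?_⟩) hT.le <;> nlinarith

lemma abs_volume_real_fractLogbSet_div_sub_le {S T : ℝ} (hS : 0 < S) (hT : 0 < T) (x : ℝ) :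
    |volume.real (fractLogbSet T x) / T - volume.real (fractLogbSet S x) / S|
      ≤ |T - S| / max T S := by
  rcases le_total S T with h | h
  · rw [abs_of_nonneg (sub_nonneg.2 h), max_eq_left h]
    exact abs_volume_real_fractLogbSet_div_sub_le_of_le hS h x
  · rw [abs_sub_comm, abs_sub_comm T, abs_of_nonneg (sub_nonneg.2 h), max_eq_right h]
    exact abs_volume_real_fractLogbSet_div_sub_le_of_le hT h x

lemma ksDistUnif_le_add {S T : ℝ} (hS : 0 < S) (hT : 0 < T) :
    ksDistUnif T ≤ ksDistUnif S + |T - S| / max T S := by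
  rw [ksDistUnif_eq_iSup hT, ksDistUnif_eq_iSup hS]
  refine ciSup_le fun x => ?_
  have h1 := le_ciSup (bddAbove_abs_sub_fractLogbSet hS) x
  have h2 := abs_volume_real_fractLogbSet_div_sub_le hS hT x
  have h3 := abs_sub_le (volume.real (fractLogbSet T x) / T)
    (volume.real (fractLogbSet S x) / S) ((volume.restrict (Ico (0 : ℝ) 1)).real (Iic x))
  linarith

lemma abs_ksDistUnif_sub_le {S T : ℝ} (hS : 0 < S) (hT : 0 < T) :
    |ksDistUnif T - ksDistUnif S| ≤ |T - S| / max T S := by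
  have h1 := ksDistUnif_le_add hS hT
  have h2 := ksDistUnif_le_add hT hS
  rw [abs_sub_comm S, max_comm S] at h2
  exact abs_sub_le_iff.2 ⟨by linarith, by linarith⟩

lemma continuousOn_ksDistUnif : ContinuousOn ksDistUnif (Ioi 0) := by
  intro S hS
  have hS' : 0 < S := hS
  refine tendsto_iff_dist_tendsto_zero.2
    (squeeze_zero' (g := fun T => |T - S| / max T S) (.of_forall fun _ => dist_nonneg) ?_ ?_)
  · filter_upwards [self_mem_nhdsWithin] with T hT
    exact abs_ksDistUnif_sub_le hS hT
  · have : ContinuousAt (fun T => |T - S| / max T S) S :=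
      ContinuousAt.div (by fun_prop) (by fun_prop) (by simpa using hS'.ne')
    simpa using this.tendsto.mono_left nhdsWithin_le_nhds


/-- There is a continuous `1`-periodic function `f : ℝ → ℝ` with `d T = f (log₁₀ T)` for all
`T > 0`; in particular `d (10 T) = d T` for all `T > 0`. -/
theorem ksDistUnif_periodic_log :
    (∃ f : ℝ → ℝ, Continuous f ∧ Function.Periodic f 1 ∧
      ∀ T : ℝ, 0 < T → ksDistUnif T = f (Real.logb 10 T)) ∧
    ∀ T : ℝ, 0 < T → ksDistUnif (10 * T) = ksDistUnif T := by
  refine ⟨⟨fun t => ksDistUnif (10 ^ t), ?_, fun t => ?_, fun T hT => ?_⟩,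
    fun T hT => ksDistUnif_ten_mul hT⟩
  · exact continuousOn_ksDistUnif.comp_continuous
      (Real.continuous_const_rpow (by norm_num)) fun t => Real.rpow_pos_of_pos (by norm_num) t
  · have h10 : (0 : ℝ) < 10 := by norm_num
    dsimp only
    rw [Real.rpow_add h10, Real.rpow_one, mul_comm,
      ksDistUnif_ten_mul (Real.rpow_pos_of_pos h10 t)]
  · dsimp only
    rw [Real.rpow_logb (by norm_num) (by norm_num) hT]
end

section
/- For every integer base b ≥ 2 there exists a constant c_b > 0 such that for every random variable X uniformly distributed on an interval (a,β) with 0 ≤ a < β, the Kolmogorov–Smirnov distance between the distribution of the fractional part of log_b X and the uniform distribution on [0,1) is at least c_b. -/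
open MeasureTheory Set

theorem abs_cdf_sub_le_ksDist (μ ν : Measure ℝ) [IsProbabilityMeasure μ]
    [IsProbabilityMeasure ν] (x : ℝ) :
    |μ.real (Iic x) - ν.real (Iic x)| ≤ ksDist μ ν := by
  refine le_ciSup (f := fun x : ℝ => |μ.real (Iic x) - ν.real (Iic x)|) ⟨1, ?_⟩ x
  rintro _ ⟨y, rfl⟩
  have h₁ : μ.real (Iic y) ≤ 1 := measureReal_le_one
  have h₂ : ν.real (Iic y) ≤ 1 := measureReal_le_one
  have h₃ : 0 ≤ μ.real (Iic y) := measureReal_nonneg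
  have h₄ : 0 ≤ ν.real (Iic y) := measureReal_nonneg
  exact abs_le.mpr ⟨by linarith, by linarith⟩

theorem measureReal_Ioc_eq_sub (μ : Measure ℝ) [IsFiniteMeasure μ] {u v : ℝ} (h : u ≤ v) :
    μ.real (Ioc u v) = μ.real (Iic v) - μ.real (Iic u) := by
  have hdiff : Ioc u v = Iic v \ Iic u := by ext x; simp [and_comm]
  rw [hdiff, measureReal_sdiff (Iic_subset_Iic.mpr h) measurableSet_Iic]

theorem abs_measureReal_Ioc_sub_le_ksDist (μ ν : Measure ℝ) [IsProbabilityMeasure μ]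
    [IsProbabilityMeasure ν] {u v : ℝ} (h : u ≤ v) :
    |μ.real (Ioc u v) - ν.real (Ioc u v)| ≤ 2 * ksDist μ ν := by
  rw [measureReal_Ioc_eq_sub μ h, measureReal_Ioc_eq_sub ν h]
  have hu := abs_le.mp (abs_cdf_sub_le_ksDist μ ν u)
  have hv := abs_le.mp (abs_cdf_sub_le_ksDist μ ν v)
  exact abs_le.mpr ⟨by linarith, by linarith⟩

theorem volume_restrict_Ico_zero_one_real_Ioc {u v : ℝ} (hu : 0 ≤ u) (huv : u ≤ v)
    (hv : v < 1) : (volume.restrict (Ico (0 : ℝ) 1)).real (Ioc u v) = v - u := by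
  have hsub : Ioc u v ⊆ Ico 0 1 := fun x hx => ⟨hu.trans hx.1.le, hx.2.trans_lt hv⟩
  rw [measureReal_restrict_apply measurableSet_Ioc, inter_eq_left.mpr hsub,
    Real.volume_real_Ioc_of_le huv]

/-- Adding `t` to a real number whose translate does not wrap around the circle. -/
theorem fract_add_of_nonneg_of_lt_one {y t : ℝ} (h₀ : 0 ≤ Int.fract y + t)
    (h₁ : Int.fract y + t < 1) : Int.fract (y + t) = Int.fract y + t :=
  Int.fract_eq_iff.mpr ⟨h₀, h₁, ⌊y⌋, by rw [Int.fract]; ring⟩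

theorem fract_add_mem_Ioc_iff {y t u : ℝ} (hu : 0 ≤ u) (hut : u + 2 * t < 1) :
    Int.fract (y + t) ∈ Ioc (u + t) (u + 2 * t) ↔ Int.fract y ∈ Ioc u (u + t) := by
  constructor
  · rintro ⟨h₁, h₂⟩
    have h := fract_add_of_nonneg_of_lt_one (y := y + t) (t := -t) (by linarith) (by linarith)
    rw [add_neg_cancel_right] at h
    exact ⟨by linarith, by linarith⟩
  · rintro ⟨h₁, h₂⟩
    rw [fract_add_of_nonneg_of_lt_one (by linarith) (by linarith)]
    exact ⟨by linarith, by linarith⟩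

/-- If `y` lies in the first half of the arc `(u, u + 2t]` modulo one, then every `z` with
`y ≤ z ≤ y + t` lies in that arc. -/
theorem fract_mem_Ioc_of_le_of_le {y z t u : ℝ} (hu : 0 ≤ u) (hut : u + 2 * t < 1)
    (hy : Int.fract y ∈ Ioc u (u + t)) (h₁ : y ≤ z) (h₂ : z ≤ y + t) :
    Int.fract z ∈ Ioc u (u + 2 * t) := by
  obtain ⟨hy₁, hy₂⟩ := hy
  have h := fract_add_of_nonneg_of_lt_one (y := y) (t := z - y) (by linarith) (by linarith)
  rw [add_sub_cancel] at h
  exact ⟨by linarith, by linarith⟩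

/-- The two points meet at most two of the three arcs `(j/4, (j+1)/4]`, `j < 3`. -/
theorem exists_Ioc_quarter_avoiding (p q : ℝ) :
    ∃ u : ℝ, 0 ≤ u ∧ u ≤ 1 / 2 ∧ p ∉ Ioc u (u + 2 * (1 / 8)) ∧ q ∉ Ioc u (u + 2 * (1 / 8)) := by
  by_contra! h
  simp only [mem_Ioc] at h
  have h₀ := h 0 (by norm_num) (by norm_num)
  have h₁ := h (1 / 4) (by norm_num) (by norm_num)
  have h₂ := h (1 / 2) (by norm_num) (by norm_num)
  grind

/-- If neither endpoint of `(a, β)` has its logarithm in the arc `(u, u + 2t]` modulo one, then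
multiplication by `b ^ t` carries the points of `(a, β)` over the first half of the arc onto those
over the second half. -/
theorem preimage_mul_Ioo_inter_fract_logb {b a β u t : ℝ} (hb : 1 < b) (ha : 0 ≤ a)
    (hu : 0 ≤ u) (ht : 0 ≤ t) (hut : u + 2 * t < 1)
    (hau : Int.fract (Real.logb b a) ∉ Ioc u (u + 2 * t))
    (hβu : Int.fract (Real.logb b β) ∉ Ioc u (u + 2 * t)) :
    (fun x => b ^ t * x) ⁻¹'
        ((fun x => Int.fract (Real.logb b x)) ⁻¹' Ioc (u + t) (u + 2 * t) ∩ Ioo a β) =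
      (fun x => Int.fract (Real.logb b x)) ⁻¹' Ioc u (u + t) ∩ Ioo a β := by
  have hb₀ : 0 < b := one_pos.trans hb
  have hq : 0 < b ^ t := Real.rpow_pos_of_pos hb₀ t
  have hq₁ : 1 ≤ b ^ t := Real.one_le_rpow hb.le ht
  ext x
  simp only [mem_preimage, mem_inter_iff]
  rcases le_or_gt x 0 with hx | hx
  · exact iff_of_false
      (fun h => (mul_nonpos_of_nonneg_of_nonpos hq.le hx).not_gt (ha.trans_lt h.2.1))
      fun h => hx.not_gt (ha.trans_lt h.2.1)
  have hlog : Real.logb b (b ^ t * x) = Real.logb b x + t := by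
    rw [Real.logb_mul hq.ne' hx.ne', Real.logb_rpow hb₀ hb.ne', add_comm]
  rw [hlog, fract_add_mem_Ioc_iff hu hut]
  refine and_congr_right fun hy => ?_
  have key {z : ℝ} (hxz : x ≤ z) (hzx : z ≤ b ^ t * x) :
      Int.fract (Real.logb b z) ∈ Ioc u (u + 2 * t) :=
    fract_mem_Ioc_of_le_of_le hu hut hy (Real.logb_le_logb_of_le hb hx hxz)
      (hlog ▸ Real.logb_le_logb_of_le hb (hx.trans_le hxz) hzx)
  have hxq : x ≤ b ^ t * x := le_mul_of_one_le_left hx.le hq₁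
  constructor
  · rintro ⟨h₁, h₂⟩
    exact ⟨not_le.mp fun h => hau (key h h₁.le), hxq.trans_lt h₂⟩
  · rintro ⟨h₁, h₂⟩
    exact ⟨h₁.trans_le hxq, not_le.mp fun h => hβu (key h₂.le h)⟩

/-- For every integer base `b ≥ 2` there is a constant `c_b > 0` such that for every random
variable `X` uniformly distributed on an interval `(a, β)` with `0 ≤ a < β`, the
Kolmogorov–Smirnov distance between the distribution of the fractional part of `log_b X`
and the uniform distribution on `[0, 1)` is at least `c_b`. -/
theorem uniform_not_benford_any_base (b : ℕ) (hb : 2 ≤ b) :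
    ∃ c : ℝ, 0 < c ∧
      ∀ (Ω : Type) (_ : MeasurableSpace Ω) (ℙ : Measure Ω), IsProbabilityMeasure ℙ →
        ∀ (X : Ω → ℝ), Measurable X →
          ∀ a β : ℝ, 0 ≤ a → a < β →
            Measure.map X ℙ = (ENNReal.ofReal (β - a))⁻¹ • volume.restrict (Ioo a β) →
            c ≤ ksDist (Measure.map (fun ω => Int.fract (Real.logb b (X ω))) ℙ)
                  (volume.restrict (Ico 0 1)) := by
  have hb₁ : (1 : ℝ) < b := by exact_mod_cast hb
  set q : ℝ := (b : ℝ) ^ (1 / 8 : ℝ) with hq_def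
  have hq : 1 < q := Real.one_lt_rpow hb₁ (by norm_num)
  have hq₀ : 0 < q := one_pos.trans hq
  refine ⟨(q - 1) / (16 * (q + 1)), by have := sub_pos.mpr hq; positivity, ?_⟩
  intro Ω _ ℙ _ X hX a β ha haβ hmap
  obtain ⟨u, hu, hu₂, hau, hβu⟩ := exists_Ioc_quarter_avoiding
    (Int.fract (Real.logb b a)) (Int.fract (Real.logb b β))
  have hg : Measurable fun x : ℝ => Int.fract (Real.logb b x) :=
    measurable_fract.comp (Real.measurable_log.div_const _)
  set ν := Measure.map (fun ω => Int.fract (Real.logb b (X ω))) ℙ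
  have : IsProbabilityMeasure ν := Measure.isProbabilityMeasure_map (hg.comp hX).aemeasurable
  have : IsProbabilityMeasure (volume.restrict (Ico (0 : ℝ) 1)) := ⟨by simp⟩
  have hν (s : Set ℝ) (hs : MeasurableSet s) : ν.real s = (β - a)⁻¹ *
      volume.real ((fun x => Int.fract (Real.logb b x)) ⁻¹' s ∩ Ioo a β) := by
    have : ν = Measure.map (fun x => Int.fract (Real.logb b x)) (Measure.map X ℙ) :=
      (Measure.map_map hg hX).symm
    rw [this, map_measureReal_apply hg hs, hmap, measureReal_ennreal_smul_apply,
      measureReal_restrict_apply (hg hs), ENNReal.toReal_inv,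
      ENNReal.toReal_ofReal (sub_pos.mpr haβ).le]
  have hscale : ν.real (Ioc (u + 1 / 8) (u + 2 * (1 / 8))) = q * ν.real (Ioc u (u + 1 / 8)) := by
    rw [hν _ measurableSet_Ioc, hν _ measurableSet_Ioc, ← preimage_mul_Ioo_inter_fract_logb hb₁ ha
      hu (by norm_num) (by linarith) hau hβu, ← hq_def, measureReal_def,
      measureReal_def, Real.volume_preimage_mul_left hq₀.ne', ENNReal.toReal_mul,
      ENNReal.toReal_ofReal (abs_nonneg _), abs_of_pos (inv_pos.mpr hq₀)]
    field_simp
  have h₁ := abs_measureReal_Ioc_sub_le_ksDist ν (volume.restrict (Ico (0 : ℝ) 1))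
    (show u ≤ u + 1 / 8 by linarith)
  have h₂ := abs_measureReal_Ioc_sub_le_ksDist ν (volume.restrict (Ico (0 : ℝ) 1))
    (show u + 1 / 8 ≤ u + 2 * (1 / 8) by linarith)
  rw [volume_restrict_Ico_zero_one_real_Ioc hu (by linarith) (by linarith)] at h₁
  rw [volume_restrict_Ico_zero_one_real_Ioc (by linarith) (by linarith) (by linarith),
    hscale] at h₂
  have h₁' := mul_le_mul_of_nonneg_left (abs_le.mp h₁).1 hq₀.le
  rw [div_le_iff₀ (by positivity)]
  linarith [(abs_le.mp h₂).2]
end
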